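/- arXiv:2202.00240 — 2 statements merged into one kernel-verified Lean document; each statement's English description precedes it below -/
import Mathlib

section
/- Let C ⊆ 𝔽₂^N be a transitive linear code and let w ∈ {0,1,…,N}. Then the probability that a uniformly random codeword c of C has Hamming weight exactly w is at most 2^{−(1−h(w/N))·dim C}. -/
/-- The binary entropy function (base 2). -/
noncomputable def binH (x : ℝ) : ℝ :=
  x * Real.logb 2 (1 / x) + (1 - x) * Real.logb 2 (1 / (1 - x))

/-- A set of vectors in 𝔽₂^N is transitive if for every pair of coordinates `i j`
there is a permutation of coordinates sending `i` to `j` that preserves the set. -/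
def IsTransitive {N : ℕ} (C : Set (Fin N → ZMod 2)) : Prop :=
  ∀ i j : Fin N, ∃ π : Equiv.Perm (Fin N),
    π i = j ∧ ∀ v ∈ C, (fun k => v (π k)) ∈ C

open Finset in
/-- If a finite set embeds into `𝔽₂^κ` so that every coordinate equals `1` on a fraction `p`
of the set, then its cardinality is at most `(p ^ p * (1 - p) ^ (1 - p)) ^ (-|κ|)`. -/
theorem card_mul_pow_le_one_of_marginals {α κ : Type*} [Fintype κ] (S : Finset α)
    (g : α → κ → ZMod 2) (hg : Set.InjOn g S) {p : ℝ} (hp0 : 0 ≤ p) (hp1 : p ≤ 1)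
    (hS : ∀ i, (#{x ∈ S | g x i = 1} : ℝ) = p * #S) :
    (#S : ℝ) * (p ^ p * (1 - p) ^ (1 - p)) ^ Fintype.card κ ≤ 1 := by
  classical
  rcases S.eq_empty_or_nonempty with rfl | hne
  · simp
  have hs : (0 : ℝ) < #S := by exact_mod_cast hne.card_pos
  have hq1 : 0 ≤ 1 - p := by linarith
  let f : ZMod 2 → ℝ := fun a => if a = 1 then p else 1 - p
  have hf : ∀ a, 0 ≤ f a := fun a => by dsimp only [f]; split_ifs <;> assumption
  have hsum : ∑ a, f a = 1 := by
    have huniv : (univ : Finset (ZMod 2)) = {0, 1} := rfl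
    rw [huniv, sum_pair zero_ne_one]
    simp [f]
  have htotal : ∑ x ∈ S, ∏ i, f (g x i) ≤ 1 := by
    calc ∑ x ∈ S, ∏ i, f (g x i) = ∑ y ∈ S.image g, ∏ i, f (y i) :=
          (sum_image (f := fun y : κ → ZMod 2 => ∏ i, f (y i)) hg).symm
      _ ≤ ∑ y : κ → ZMod 2, ∏ i, f (y i) :=
          sum_le_sum_of_subset_of_nonneg (subset_univ _)
            fun y _ _ => prod_nonneg fun i _ => hf _
      _ = ∏ _i : κ, ∑ a, f a := by
          rw [prod_univ_sum, Fintype.piFinset_univ]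
      _ = 1 := by simp [hsum]
  have hamgm := Real.geom_mean_le_arith_mean_weighted S (fun _ => (#S : ℝ)⁻¹)
    (fun x => ∏ i, f (g x i)) (fun _ _ => by positivity)
    (by rw [sum_const, nsmul_eq_mul, mul_inv_cancel₀ hs.ne'])
    (fun x _ => prod_nonneg fun i _ => hf _)
  have hprod : ∏ x ∈ S, (∏ i, f (g x i)) ^ (#S : ℝ)⁻¹ =
      (p ^ p * (1 - p) ^ (1 - p)) ^ Fintype.card κ := by
    have hcoord : ∀ i, ∏ x ∈ S, f (g x i) ^ (#S : ℝ)⁻¹ = p ^ p * (1 - p) ^ (1 - p) := by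
      intro i
      have hcompl : (#{x ∈ S | ¬ g x i = 1} : ℝ) = (1 - p) * #S := by
        have h := card_filter_add_card_filter_not (s := S) (fun x => g x i = 1)
        have h' : (#{x ∈ S | g x i = 1} : ℝ) + #{x ∈ S | ¬ g x i = 1} = #S := by
          exact_mod_cast h
        rw [hS i] at h'
        linarith
      simp only [f, apply_ite (fun t : ℝ => t ^ (#S : ℝ)⁻¹)]
      rw [prod_ite, prod_const, prod_const, ← Real.rpow_mul_natCast hp0,
        ← Real.rpow_mul_natCast hq1, hS i, hcompl]
      congr 2 <;> field_simp
    calc ∏ x ∈ S, (∏ i, f (g x i)) ^ (#S : ℝ)⁻¹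
        = ∏ x ∈ S, ∏ i, f (g x i) ^ (#S : ℝ)⁻¹ :=
          prod_congr rfl fun x _ => (Real.finsetProd_rpow _ _ (fun i _ => hf _) _).symm
      _ = _ := by rw [prod_comm, prod_congr rfl fun i _ => hcoord i, prod_const, card_univ]
  rw [hprod, ← mul_sum] at hamgm
  calc _ ≤ (#S : ℝ) * ((#S : ℝ)⁻¹ * ∑ x ∈ S, ∏ i, f (g x i)) := by gcongr
    _ = ∑ x ∈ S, ∏ i, f (g x i) := by field_simp
    _ ≤ 1 := htotal

/-- A linear code has a set of at most `dim C` coordinates that determines each codeword. -/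
theorem exists_information_set {F ι : Type*} [Field F] [Finite ι] (C : Submodule F (ι → F)) :
    ∃ I : Finset ι, I.card ≤ Module.finrank F C ∧
      ∀ c ∈ C, ∀ d ∈ C, (∀ i ∈ I, c i = d i) → c = d := by
  classical
  have := Fintype.ofFinite ι
  let φ : ι → Module.Dual F C := fun i => (LinearMap.proj i).comp C.subtype
  obtain ⟨κ, a, ha, hspan, hli⟩ := exists_linearIndependent' F φ
  have := Fintype.ofInjective a ha
  refine ⟨Finset.univ.image a, ?_, fun c hc d hd h => ?_⟩
  · rw [Finset.card_image_of_injective _ ha, Finset.card_univ, ← Subspace.dual_finrank_eq]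
    exact hli.fintype_card_le_finrank
  · let x : C := ⟨c, hc⟩ - ⟨d, hd⟩
    have hle : Submodule.span F (Set.range φ) ≤ LinearMap.ker (Module.Dual.eval F C x) := by
      rw [← hspan, Submodule.span_le]
      rintro _ ⟨k, rfl⟩
      have := h (a k) (by simp)
      simp [φ, x, this]
    funext i
    have := hle (Submodule.subset_span ⟨i, rfl⟩)
    simpa [φ, x, sub_eq_zero] using this

theorem two_rpow_neg_binH {p : ℝ} (hp0 : 0 ≤ p) (hp1 : p ≤ 1) :
    (2 : ℝ) ^ (-binH p) = p ^ p * (1 - p) ^ (1 - p) := by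
  have key : ∀ q : ℝ, 0 ≤ q → (2 : ℝ) ^ (q * Real.logb 2 q) = q ^ q := by
    intro q hq
    rcases hq.eq_or_lt with rfl | hq
    · simp
    · rw [mul_comm, Real.rpow_mul two_pos.le, Real.rpow_logb two_pos (by norm_num) hq]
  rw [← key p hp0, ← key (1 - p) (by linarith), ← Real.rpow_add two_pos]
  congr 1
  simp only [binH, one_div, Real.logb_inv]
  ring

open Finset in
/-- In a finite permutation-transitive family of vectors of weight `w`, each coordinate equals `1`
on a fraction `w / N` of the family. -/
theorem card_filter_eq_one_of_isTransitive {N : ℕ} (S : Finset (Fin N → ZMod 2))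
    (hS : IsTransitive (S : Set (Fin N → ZMod 2))) {w : ℕ} (hw : ∀ c ∈ S, hammingNorm c = w)
    (i : Fin N) : (#{c ∈ S | c i = 1} : ℝ) = (w / N : ℝ) * #S := by
  have hle : ∀ i j : Fin N, #{c ∈ S | c j = 1} ≤ #{c ∈ S | c i = 1} := by
    intro i j
    obtain ⟨π, rfl, hπ⟩ := hS i j
    refine card_le_card_of_injOn (fun v k => v (π k)) ?_ ?_
    · intro v hv
      simp only [coe_filter, Set.mem_ofPred_eq] at hv ⊢
      exact ⟨hπ v hv.1, hv.2⟩
    · intro v _ v' _ h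
      funext k
      simpa using congrFun h (π.symm k)
  have hdouble : ∑ j, #{c ∈ S | c j = 1} = ∑ c ∈ S, #{j | c j = 1} := by
    simp only [card_filter]
    exact sum_comm
  have hne : ∀ a : ZMod 2, a ≠ 0 ↔ a = 1 := by decide
  have hweight : ∀ c ∈ S, #{j | c j = 1} = w := by
    intro c hc
    rw [← hw c hc, hammingNorm]
    simp only [hne]
  rw [sum_congr rfl hweight, sum_congr rfl fun j _ => (hle i j).antisymm (hle j i)] at hdouble
  simp only [sum_const, card_univ, Fintype.card_fin, smul_eq_mul] at hdouble
  have hN : (N : ℝ) ≠ 0 := by exact_mod_cast i.pos.ne'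
  have : (N : ℝ) * #{c ∈ S | c i = 1} = #S * w := by exact_mod_cast hdouble
  field_simp
  linarith

theorem hammingNorm_comp_perm {ι β : Type*} [Fintype ι] [DecidableEq β] [Zero β]
    (π : Equiv.Perm ι) (v : ι → β) : hammingNorm (fun k => v (π k)) = hammingNorm v := by
  classical
  simp only [hammingNorm, Finset.card_filter]
  exact Equiv.sum_comp π fun k => if v k ≠ 0 then 1 else 0

theorem weight_distribution_transitive (N : ℕ) (hN : 0 < N)
    (C : Submodule (ZMod 2) (Fin N → ZMod 2))
    (hC : IsTransitive (C : Set (Fin N → ZMod 2)))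
    (w : ℕ) (hw : w ≤ N) :
    (Nat.card {c : Fin N → ZMod 2 | c ∈ C ∧ hammingNorm c = w} : ℝ) / (Nat.card C : ℝ)
      ≤ (2 : ℝ) ^ (-((1 - binH ((w : ℝ) / (N : ℝ))) * (Module.finrank (ZMod 2) C : ℝ))) := by
  classical
  have hN' : (0 : ℝ) < N := by exact_mod_cast hN
  set p : ℝ := (w : ℝ) / N
  have hp0 : 0 ≤ p := by positivity
  have hp1 : p ≤ 1 := (div_le_one hN').2 (by exact_mod_cast hw)
  set k := Module.finrank (ZMod 2) C
  let S : Finset (Fin N → ZMod 2) := {c | c ∈ C ∧ hammingNorm c = w}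
  have hScard : Nat.card {c : Fin N → ZMod 2 | c ∈ C ∧ hammingNorm c = w} = S.card := by
    rw [Nat.card_coe_set_eq, ← Set.ncard_coe_finset]
    simp [S]
  have hStrans : IsTransitive (S : Set (Fin N → ZMod 2)) := by
    intro i j
    obtain ⟨π, hij, hπ⟩ := hC i j
    refine ⟨π, hij, fun v hv => ?_⟩
    simp only [S, Finset.coe_filter, Finset.mem_univ, true_and, Set.mem_ofPred_eq] at hv ⊢
    exact ⟨hπ v hv.1, (hammingNorm_comp_perm π v).trans hv.2⟩
  obtain ⟨I, hIcard, hI⟩ := exists_information_set C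
  have hbound := card_mul_pow_le_one_of_marginals (κ := I) S (fun c i => c i)
    (fun c hc d hd h => hI c (Finset.mem_filter.1 hc).2.1 d (Finset.mem_filter.1 hd).2.1
      fun i hi => congrFun h ⟨i, hi⟩) hp0 hp1
    (fun i => card_filter_eq_one_of_isTransitive S hStrans
      (fun c hc => (Finset.mem_filter.1 hc).2.2) i)
  have hbase0 : 0 ≤ p ^ p * (1 - p) ^ (1 - p) :=
    mul_nonneg (Real.rpow_nonneg hp0 _) (Real.rpow_nonneg (by linarith) _)
  have hbase1 : p ^ p * (1 - p) ^ (1 - p) ≤ 1 :=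
    mul_le_one₀ (Real.rpow_le_one hp0 hp1 hp0) (Real.rpow_nonneg (by linarith) _)
      (Real.rpow_le_one (by linarith) (by linarith) (by linarith))
  have hSk : (S.card : ℝ) * (p ^ p * (1 - p) ^ (1 - p)) ^ k ≤ 1 := by
    refine le_trans ?_ hbound
    rw [Fintype.card_coe]
    exact mul_le_mul_of_nonneg_left (pow_le_pow_of_le_one hbase0 hbase1 hIcard) (by positivity)
  rw [← two_rpow_neg_binH hp0 hp1, ← Real.rpow_mul_natCast two_pos.le, neg_mul,
    Real.rpow_neg two_pos.le, ← div_eq_mul_inv, div_le_one (by positivity)] at hSk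
  have hCcard : (Nat.card C : ℝ) = (2 : ℝ) ^ (k : ℝ) := by
    rw [Module.natCard_eq_pow_finrank (K := ZMod 2), Nat.card_zmod, Real.rpow_natCast]
    push_cast
    rfl
  rw [hScard, hCcard, div_le_iff₀ (by positivity), ← Real.rpow_add two_pos]
  refine hSk.trans_eq ?_
  congr 1
  ring
end

section
/- Let ε, δ ∈ (0,1/2) and let N be a positive integer such that εN and δN are integers. If δ < 1/2 − √(ε(1−ε)) (equivalently (1−2δ)² − 4ε(1−ε) ≥ 0), then |L̂_{{εN}}(1_{δN})| ≤ 2^{−N/2} · ( (1/2 − δ)·e²/ε )^{εN}; otherwise |L̂_{{εN}}(1_{δN})| ≤ 2^{(h(ε) − h(δ))·N/2}. -/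
/-- The vector in 𝔽₂^N with ones in the first `w` coordinates and zeros elsewhere. -/
def oneVec (N w : ℕ) : Fin N → ZMod 2 := fun i => if (i : ℕ) < w then 1 else 0

/-- The normalized Fourier coefficient of the level function `L_S`:
`L̂_S(y) = 2^{-N/2} Σ_x L_S(x) (-1)^{⟨x,y⟩}`. -/
noncomputable def FourierL (N : ℕ) (S : Finset ℕ) (y : Fin N → ZMod 2) : ℝ :=
  (2 : ℝ) ^ (-(N : ℝ) / 2) *
    ∑ x : Fin N → ZMod 2,
      (if hammingNorm x ∈ S then (1 : ℝ) else 0) * (-1 : ℝ) ^ ((∑ j, x j * y j).val)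

open Polynomial in
/-- Cauchy's estimate for the coefficients of a complex polynomial. -/
theorem Polynomial.norm_coeff_mul_pow_le_of_forall_norm_eval_le (p : ℂ[X]) (n : ℕ) {r C : ℝ}
    (hr : 0 < r) (h : ∀ z : ℂ, ‖z‖ = r → ‖p.eval z‖ ≤ C) : ‖p.coeff n‖ * r ^ n ≤ C := by
  have h1 := Complex.norm_iteratedDeriv_le_of_forall_mem_sphere_norm_le (c := 0) n hr
    p.differentiable.diffContOnCl (C := C) (fun z hz => h z (by simpa using hz))
  have h2 : iteratedDeriv n (fun x => p.eval x) 0 = n.factorial * p.coeff n := by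
    have h3 : ∀ k, deriv^[k] (fun x => p.eval x) = fun x => (derivative^[k] p).eval x := by
      intro k
      induction k with
      | zero => rfl
      | succ k ih =>
        rw [Function.iterate_succ_apply', ih, Function.iterate_succ_apply']
        ext x
        simp
    rw [iteratedDeriv_eq_iterate, h3]
    simp [← coeff_zero_eq_eval_zero, coeff_iterate_derivative, Nat.descFactorial_self]
  rw [h2, norm_mul, Complex.norm_natCast, le_div_iff₀ (by positivity), mul_assoc] at h1
  exact le_of_mul_le_mul_left h1 (by positivity)

theorem neg_one_pow_val_sum {R ι : Type*} [CommRing R] (s : Finset ι) (f : ι → ZMod 2) :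
    (-1 : R) ^ (∑ j ∈ s, f j).val = ∏ j ∈ s, (-1) ^ (f j).val := by
  classical
  have key : ∀ u v : ZMod 2, (-1 : ℤ) ^ (u + v).val = (-1) ^ u.val * (-1) ^ v.val := by decide
  induction s using Finset.induction_on with
  | empty => simp
  | insert i s hi ih =>
    rw [Finset.sum_insert hi, Finset.prod_insert hi, ← ih]
    simpa using congrArg (Int.cast : ℤ → R) (key (f i) (∑ j ∈ s, f j))

open Polynomial in
/-- The generating function of the character sums over Hamming spheres. -/
theorem prod_one_add_sign_mul_X (N : ℕ) (y : Fin N → ZMod 2) :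
    ∏ j, (1 + C ((-1 : ℂ) ^ (y j).val) * X) =
      ∑ x : Fin N → ZMod 2, C ((-1 : ℂ) ^ (∑ j, x j * y j).val) * X ^ hammingNorm x := by
  have h1 : ∀ j, (1 + C ((-1 : ℂ) ^ (y j).val) * X) =
      ∑ u : ZMod 2, C ((-1 : ℂ) ^ (u * y j).val) * (if u ≠ 0 then X else 1) := by
    intro j
    have : (Finset.univ : Finset (ZMod 2)) = {0, 1} := rfl
    rw [this, Finset.sum_pair (by decide)]
    simp
  simp_rw [h1]
  rw [Fintype.prod_sum]
  refine Finset.sum_congr rfl fun x _ => ?_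
  rw [Finset.prod_mul_distrib, neg_one_pow_val_sum, map_prod]
  congr 1
  rw [Finset.prod_ite]
  simp [hammingNorm]

theorem sum_level_mul_sign_eq_coeff (N a : ℕ) (y : Fin N → ZMod 2) :
    ((∑ x : Fin N → ZMod 2, (if hammingNorm x ∈ ({a} : Finset ℕ) then (1 : ℝ) else 0) *
      (-1 : ℝ) ^ ((∑ j, x j * y j).val) : ℝ) : ℂ) =
      (∏ j, (1 + Polynomial.C ((-1 : ℂ) ^ (y j).val) * Polynomial.X)).coeff a := by
  rw [prod_one_add_sign_mul_X, Polynomial.finsetSum_coeff]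
  push_cast
  refine Finset.sum_congr rfl fun x _ => ?_
  rw [Polynomial.coeff_C_mul_X_pow]
  by_cases h : hammingNorm x = a
  · simp [h]
  · simp [h, Ne.symm h]

theorem prod_sign_oneVec {N b : ℕ} (hb : b ≤ N) (z : ℂ) :
    ∏ j, (1 + (-1 : ℂ) ^ (oneVec N b j).val * z) = (1 - z) ^ b * (1 + z) ^ (N - b) := by
  have hc : (Finset.univ.filter (fun i : Fin N => (i : ℕ) < b)).card = b := by
    rw [Fin.card_filter_val_lt, min_eq_right hb]
  have h : ∀ j : Fin N, (1 + (-1 : ℂ) ^ (oneVec N b j).val * z) =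
      if (j : ℕ) < b then 1 - z else 1 + z := by
    intro j
    unfold oneVec
    split_ifs
    · rw [show (1 : ZMod 2).val = 1 from rfl]; ring
    · simp
  simp_rw [h]
  rw [Finset.prod_ite, Finset.prod_const, Finset.prod_const, hc, Finset.filter_not,
    Finset.card_sdiff_of_subset (Finset.filter_subset _ _), hc]
  simp

/-- A bound on `‖1 - z‖ ^ (2 b) ‖1 + z‖ ^ (2 (N - b))` over the circle of radius `r` bounds the
Fourier coefficient. -/
theorem FourierL_sq_mul_le {N a b : ℕ} (hb : b ≤ N) {r M : ℝ} (hr : 0 < r)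
    (h : ∀ t : ℝ, |t| ≤ 2 * r → (1 + r ^ 2 - t) ^ b * (1 + r ^ 2 + t) ^ (N - b) ≤ M) :
    FourierL N {a} (oneVec N b) ^ 2 * (r ^ 2) ^ a ≤ (2 : ℝ) ^ (-(N : ℝ)) * M := by
  have hM : 0 ≤ M := by
    have h0 := h 0 (by simpa using hr.le)
    rw [sub_zero] at h0
    exact le_trans (by positivity) h0
  unfold FourierL
  set S := ∑ x : Fin N → ZMod 2, (if hammingNorm x ∈ ({a} : Finset ℕ) then (1 : ℝ) else 0) *
      (-1 : ℝ) ^ ((∑ j, x j * oneVec N b j).val) with hS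
  have key : ‖(S : ℂ)‖ * r ^ a ≤ √M := by
    rw [hS, sum_level_mul_sign_eq_coeff]
    refine Polynomial.norm_coeff_mul_pow_le_of_forall_norm_eval_le _ _ hr fun z hz => ?_
    rw [Polynomial.eval_prod]
    simp only [Polynomial.eval_add, Polynomial.eval_one, Polynomial.eval_mul, Polynomial.eval_C,
      Polynomial.eval_X]
    rw [prod_sign_oneVec hb, norm_mul, norm_pow, norm_pow]
    refine Real.le_sqrt_of_sq_le ?_
    have hre : |2 * z.re| ≤ 2 * r := by
      rw [abs_mul, abs_two, ← hz]
      exact mul_le_mul_of_nonneg_left (Complex.abs_re_le_norm z) zero_le_two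
    have hz2 : r ^ 2 = z.re ^ 2 + z.im ^ 2 := by
      rw [← hz, Complex.sq_norm, Complex.normSq_apply]; ring
    have hu : ‖1 - z‖ ^ 2 = 1 + r ^ 2 - 2 * z.re := by
      rw [hz2, Complex.sq_norm, Complex.normSq_apply]
      simp
      ring
    have hv : ‖1 + z‖ ^ 2 = 1 + r ^ 2 + 2 * z.re := by
      rw [hz2, Complex.sq_norm, Complex.normSq_apply]
      simp
      ring
    calc (‖1 - z‖ ^ b * ‖1 + z‖ ^ (N - b)) ^ 2
        = (‖1 - z‖ ^ 2) ^ b * (‖1 + z‖ ^ 2) ^ (N - b) := by ring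
      _ ≤ M := by rw [hu, hv]; exact h _ hre
  have h2 : ((2 : ℝ) ^ (-(N : ℝ) / 2)) ^ 2 = (2 : ℝ) ^ (-(N : ℝ)) := by
    rw [← Real.rpow_natCast, ← Real.rpow_mul zero_le_two]
    congr 1
    push_cast
    ring
  have hsq : S ^ 2 * (r ^ 2) ^ a ≤ M := by
    rw [Complex.norm_real, Real.norm_eq_abs] at key
    have := pow_le_pow_left₀ (by positivity) key 2
    rw [Real.sq_sqrt hM, mul_pow, sq_abs] at this
    calc S ^ 2 * (r ^ 2) ^ a = S ^ 2 * (r ^ a) ^ 2 := by ring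
      _ ≤ M := this
  rw [mul_pow, h2, mul_assoc]
  exact mul_le_mul_of_nonneg_left hsq (by positivity)

theorem pow_le_exp_mul_sub_one {x : ℝ} (hx : 0 ≤ x) (n : ℕ) :
    x ^ n ≤ Real.exp (n * (x - 1)) := by
  rw [Real.exp_nat_mul]
  refine pow_le_pow_left₀ hx ?_ n
  linarith [Real.add_one_le_exp (x - 1)]

theorem two_rpow_binH_mul {p : ℝ} (hp : 0 < p) (hp' : p < 1) {N k : ℕ} (hk : (k : ℝ) = p * N) :
    (2 : ℝ) ^ (binH p * N) = (p ^ k * (1 - p) ^ ((N : ℝ) - k))⁻¹ := by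
  have h1 : 0 < 1 - p := by linarith
  have e : binH p * N = -(Real.logb 2 p * k + Real.logb 2 (1 - p) * (N - k)) := by
    rw [hk, binH, one_div, one_div, Real.logb_inv, Real.logb_inv]
    ring
  rw [e, Real.rpow_neg zero_le_two, Real.rpow_add zero_lt_two, Real.rpow_mul zero_le_two,
    Real.rpow_mul zero_le_two, Real.rpow_logb zero_lt_two (by norm_num) hp,
    Real.rpow_logb zero_lt_two (by norm_num) h1, Real.rpow_natCast]

/-- Weighted AM-GM in the form maximising `u ^ b * v ^ (N - b)` at fixed `u + v`. -/
theorem pow_mul_pow_le_of_add_eq {δ u v A : ℝ} {N b : ℕ} (hb : b ≤ N) (hδ : 0 < δ) (hδ' : δ < 1)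
    (hbδ : (b : ℝ) = δ * N) (hu : 0 ≤ u) (hv : 0 ≤ v) (hA : 0 < A) (huv : u + v = A) :
    u ^ b * v ^ (N - b) ≤ A ^ N * (δ ^ b * (1 - δ) ^ (N - b)) := by
  have h1 : 0 < 1 - δ := by linarith
  have e1 := pow_le_exp_mul_sub_one (x := u / (A * δ)) (by positivity) b
  have e2 := pow_le_exp_mul_sub_one (x := v / (A * (1 - δ))) (by positivity) (N - b)
  have e3 := mul_le_mul e1 e2 (by positivity) (by positivity)
  rw [← Real.exp_add, Nat.cast_sub hb, hbδ, show δ * N * (u / (A * δ) - 1) +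
    (N - δ * N) * (v / (A * (1 - δ)) - 1) = 0 by
      rw [← huv] at hA ⊢
      field_simp
      ring, Real.exp_zero] at e3
  calc u ^ b * v ^ (N - b)
      = (u / (A * δ)) ^ b * (v / (A * (1 - δ))) ^ (N - b) *
        (A ^ (b + (N - b)) * (δ ^ b * (1 - δ) ^ (N - b))) := by
        rw [div_pow, div_pow, mul_pow, mul_pow, pow_add]
        field_simp
    _ ≤ 1 * (A ^ (b + (N - b)) * (δ ^ b * (1 - δ) ^ (N - b))) :=
        mul_le_mul_of_nonneg_right e3 (by positivity)
    _ = _ := by rw [one_mul, Nat.add_sub_cancel' hb]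

/-- The entropy bound, valid for all `ε` and `δ` in `(0, 1)`. -/
theorem abs_FourierL_le_two_rpow_binH {ε δ : ℝ} (hε : 0 < ε) (hε' : ε < 1) (hδ : 0 < δ)
    (hδ' : δ < 1) {N a b : ℕ} (ha : (a : ℝ) = ε * N) (hb : (b : ℝ) = δ * N) :
    |FourierL N {a} (oneVec N b)| ≤ (2 : ℝ) ^ ((binH ε - binH δ) * N / 2) := by
  have haN : a ≤ N := by
    have : (a : ℝ) ≤ N := by rw [ha]; exact mul_le_of_le_one_left (by positivity) hε'.le
    exact_mod_cast this
  have hbN : b ≤ N := by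
    have : (b : ℝ) ≤ N := by rw [hb]; exact mul_le_of_le_one_left (by positivity) hδ'.le
    exact_mod_cast this
  have h1ε : 0 < 1 - ε := by linarith
  have h1δ : 0 < 1 - δ := by linarith
  have hr2 : √(ε / (1 - ε)) ^ 2 = ε / (1 - ε) := Real.sq_sqrt (by positivity)
  have hr : 0 < √(ε / (1 - ε)) := Real.sqrt_pos.2 (by positivity)
  have key := FourierL_sq_mul_le (a := a) hbN hr
    (M := (2 * (1 / (1 - ε))) ^ N * (δ ^ b * (1 - δ) ^ (N - b))) (by
      intro t ht
      rw [abs_le] at ht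
      refine pow_mul_pow_le_of_add_eq hbN hδ hδ' hb ?_ ?_ (by positivity) ?_
      · nlinarith [sq_nonneg (1 - √(ε / (1 - ε)))]
      · nlinarith [sq_nonneg (1 - √(ε / (1 - ε)))]
      · rw [hr2]
        field_simp
        ring)
  rw [hr2] at key
  refine abs_le_of_sq_le_sq ?_ (by positivity)
  have hR : ((2 : ℝ) ^ ((binH ε - binH δ) * N / 2)) ^ 2 =
      (ε ^ a * (1 - ε) ^ (N - a))⁻¹ * (δ ^ b * (1 - δ) ^ (N - b)) := by
    rw [← Real.rpow_natCast, ← Real.rpow_mul zero_le_two,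
      show (binH ε - binH δ) * N / 2 * ((2 : ℕ) : ℝ) = binH ε * N - binH δ * N by
        push_cast; ring, Real.rpow_sub zero_lt_two, two_rpow_binH_mul hε hε' ha,
      two_rpow_binH_mul hδ hδ' hb, ← Nat.cast_sub haN, ← Nat.cast_sub hbN, Real.rpow_natCast,
      Real.rpow_natCast, div_inv_eq_mul]
  rw [hR]
  have hpow : (1 - ε) ^ N = (1 - ε) ^ a * (1 - ε) ^ (N - a) := by
    rw [← pow_add, Nat.add_sub_cancel' haN]
  refine le_of_mul_le_mul_right (key.trans (le_of_eq ?_)) (pow_pos (div_pos hε h1ε) a)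
  rw [Real.rpow_neg zero_le_two, Real.rpow_natCast, mul_pow, div_pow, div_pow, hpow, one_pow]
  field_simp

theorem two_le_exp_three_quarters : 2 ≤ Real.exp (3 / 4) := by
  have h := Real.quadratic_le_exp_of_nonneg (x := 3 / 4) (by norm_num)
  norm_num at h
  linarith

/-- The bound obtained from `1 + x ≤ exp x` on the circle of radius `ε / (1 - 2δ)`. -/
theorem abs_FourierL_le_exp_pow {ε δ : ℝ} (hε : 0 < ε) (hε' : ε < 1 / 2)
    (hδ' : δ < 1 / 2) (h : 4 * (ε * (1 - ε)) ≤ (1 - 2 * δ) ^ 2) {N a b : ℕ}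
    (ha : (a : ℝ) = ε * N) (hb : (b : ℝ) = δ * N) :
    |FourierL N {a} (oneVec N b)| ≤
      (2 : ℝ) ^ (-(N : ℝ) / 2) * ((1 / 2 - δ) * Real.exp 1 ^ 2 / ε) ^ a := by
  have hbN : b ≤ N := by
    have : (b : ℝ) ≤ N := by rw [hb]; exact mul_le_of_le_one_left (by positivity) (by linarith)
    exact_mod_cast this
  obtain ⟨s, hs⟩ : ∃ s, s = 1 - 2 * δ := ⟨_, rfl⟩
  rw [← hs] at h
  have hs0 : 0 < s := by linarith
  obtain ⟨r, hr⟩ : ∃ r, r = ε / s := ⟨_, rfl⟩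
  have hr0 : 0 < r := by rw [hr]; positivity
  have hrs : r * s = ε := by rw [hr]; field_simp
  have hr2 : r ^ 2 ≤ ε / 2 := by
    rw [hr, div_pow, div_le_iff₀ (by positivity)]
    nlinarith
  have key := FourierL_sq_mul_le (a := a) hbN hr0 (M := Real.exp (5 / 2) ^ a) (by
    intro t ht
    rw [abs_le] at ht
    have e1 := pow_le_exp_mul_sub_one (x := 1 + r ^ 2 - t)
      (by nlinarith [sq_nonneg (1 - r)]) b
    have e2 := pow_le_exp_mul_sub_one (x := 1 + r ^ 2 + t)
      (by nlinarith [sq_nonneg (1 - r)]) (N - b)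
    refine (mul_le_mul e1 e2 (pow_nonneg (by nlinarith [sq_nonneg (1 - r)]) _)
      (by positivity)).trans ?_
    rw [← Real.exp_add, ← Real.exp_nat_mul, Real.exp_le_exp, Nat.cast_sub hbN, hb, ha]
    have : r ^ 2 + t * s ≤ ε * (5 / 2) := by nlinarith
    have := mul_le_mul_of_nonneg_right this (Nat.cast_nonneg (α := ℝ) N)
    rw [hs] at this
    linarith)
  refine abs_le_of_sq_le_sq ?_ (by
    have : 0 < 1 / 2 - δ := by linarith
    positivity)
  have h2 : ((2 : ℝ) ^ (-(N : ℝ) / 2)) ^ 2 = (2 : ℝ) ^ (-(N : ℝ)) := by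
    rw [← Real.rpow_natCast, ← Real.rpow_mul zero_le_two]
    congr 1
    push_cast
    ring
  refine le_of_mul_le_mul_right (key.trans ?_) (pow_pos (pow_pos hr0 2) a)
  rw [mul_pow, h2, mul_assoc]
  refine mul_le_mul_of_nonneg_left ?_ (by positivity)
  rw [← pow_mul, mul_comm a 2, pow_mul, ← mul_pow]
  refine pow_le_pow_left₀ (by positivity) ?_ a
  have hX : (1 / 2 - δ) * Real.exp 1 ^ 2 / ε * r = Real.exp 1 ^ 2 / 2 := by
    rw [hr, hs]
    have : 1 - 2 * δ ≠ 0 := by rw [← hs]; exact hs0.ne'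
    field_simp
  rw [← mul_pow, hX]
  have e1 : Real.exp 1 ^ 2 = Real.exp (5 / 4) * Real.exp (3 / 4) := by
    rw [← Real.exp_add, ← Real.exp_nat_mul]; norm_num
  have e2 : Real.exp (5 / 2) = Real.exp (5 / 4) ^ 2 := by
    rw [← Real.exp_nat_mul]; norm_num
  rw [e1, e2]
  refine pow_le_pow_left₀ (by positivity) ?_ 2
  nlinarith [two_le_exp_three_quarters, Real.exp_pos (5 / 4)]

theorem fourier_level_explicit_bound (ε δ : ℝ)
    (hε : ε ∈ Set.Ioo (0 : ℝ) (1 / 2)) (hδ : δ ∈ Set.Ioo (0 : ℝ) (1 / 2))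
    (N a b : ℕ) (hN : 0 < N) (ha : (a : ℝ) = ε * N) (hb : (b : ℝ) = δ * N) :
    (δ < 1 / 2 - Real.sqrt (ε * (1 - ε)) →
      |FourierL N {a} (oneVec N b)| ≤
        (2 : ℝ) ^ (-(N : ℝ) / 2) * ((1 / 2 - δ) * Real.exp 1 ^ 2 / ε) ^ a) ∧
    (¬ δ < 1 / 2 - Real.sqrt (ε * (1 - ε)) →
      |FourierL N {a} (oneVec N b)| ≤
        (2 : ℝ) ^ ((binH ε - binH δ) * N / 2)) := by
  obtain ⟨hε0, hε1⟩ := hε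
  obtain ⟨hδ0, hδ1⟩ := hδ
  refine ⟨fun h => ?_, fun _ => ?_⟩
  · refine abs_FourierL_le_exp_pow hε0 hε1 hδ1 ?_ ha hb
    have hs : Real.sqrt (ε * (1 - ε)) ≤ (1 - 2 * δ) / 2 := by linarith
    have := (Real.sqrt_le_left (by linarith)).1 hs
    linarith
  · exact abs_FourierL_le_two_rpow_binH hε0 (by linarith) hδ0 (by linarith) ha hb
end
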